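/- arXiv:2301.00633 — 2 statements merged into one kernel-verified Lean document; each statement's English description precedes it below -/
import Mathlib

section
/- Let d ≥ 1 and n = 2^d. If (M,Z) and (M′,Z′) are two pairs, each consisting of a Pascal-like matrix and an n × n matrix over 𝔽₂, whose associated (n,n,n,n)-affine arrays are equal as functions, then M = M′ and Z = Z′. In other words, the map sending a pair (M,Z) to its (n,n,n,n)-affine array is injective. -/
/-- Entries of the Pascal-triangle matrix `M_d` (block recursive definition),
indexed by natural numbers. -/
def MdEnt : ℕ → ℕ → ℕ → ZMod 2
  | 0, _, _ => 1
  | d+1, i, j =>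
    if i < 2 ^ d then
      if j < 2 ^ d then MdEnt d i j else MdEnt d i (j - 2 ^ d)
    else
      if j < 2 ^ d then 0 else MdEnt d (i - 2 ^ d) (j - 2 ^ d)

/-- The matrix `M_d` over `𝔽₂`: `M_0 = (1)` and `M_{d+1} = [[M_d, M_d],[0, M_d]]`. -/
def Md (d : ℕ) : Matrix (Fin (2 ^ d)) (Fin (2 ^ d)) (ZMod 2) :=
  Matrix.of fun i j => MdEnt d (i : ℕ) (j : ℕ)

/-- The `s × t` array `P` occurs at position `(k, l)` in the toroidal array `A`. -/
def Occurs {N s t : ℕ} (A : ZMod N → ZMod N → ZMod 2)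
    (P : Fin s → Fin t → ZMod 2) (k l : ZMod N) : Prop :=
  ∀ (i : Fin s) (j : Fin t), A (k + ((i : ℕ) : ZMod N)) (l + ((j : ℕ) : ZMod N)) = P i j

/-- The toroidal array `A` of size `N × N` is `(s,t,p,q)`-perfect. -/
def IsPerfect (N s t p q : ℕ) (A : ZMod N → ZMod N → ZMod 2) : Prop :=
  ∀ (P : Fin s → Fin t → ZMod 2) (a b : ℕ), a < p → b < q →
    ∃! kl : Fin N × Fin N,
      (kl.1 : ℕ) % p = a ∧ (kl.2 : ℕ) % q = b ∧
        Occurs A P (((kl.1 : ℕ) : ZMod N)) (((kl.2 : ℕ) : ZMod N))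

/-- `B` is an aligned subarray of `A` of size `L × L` (where `L` divides `N`). -/
def IsAlignedSub (N L : ℕ) (A : ZMod N → ZMod N → ZMod 2)
    (B : ZMod L → ZMod L → ZMod 2) : Prop :=
  ∃ p q : ℕ, p < N / L ∧ q < N / L ∧
    ∀ (x y : Fin L),
      B ((x : ℕ) : ZMod L) ((y : ℕ) : ZMod L) =
        A (((p * L + (x : ℕ) : ℕ) : ZMod N)) (((q * L + (y : ℕ) : ℕ) : ZMod N))

/-- Nestedness of an `(n,n,n,n)`-perfect toroidal array of size
`n·2^{n²/2} × n·2^{n²/2}`. -/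
def IsNested (n : ℕ)
    (A : ZMod (n * 2 ^ (n ^ 2 / 2)) → ZMod (n * 2 ^ (n ^ 2 / 2)) → ZMod 2) : Prop :=
  ∀ k, 1 ≤ k → k ≤ n →
    ∀ B : ZMod (n * 2 ^ (n * k / 2)) → ZMod (n * 2 ^ (n * k / 2)) → ZMod 2,
      IsAlignedSub (n * 2 ^ (n ^ 2 / 2)) (n * 2 ^ (n * k / 2)) A B →
        IsPerfect (n * 2 ^ (n * k / 2)) k n n n B

/-- A nested `(n,n,n,n)`-perfect toroidal array. -/
def IsNestedPerfect (n : ℕ)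
    (A : ZMod (n * 2 ^ (n ^ 2 / 2)) → ZMod (n * 2 ^ (n ^ 2 / 2)) → ZMod 2) : Prop :=
  IsPerfect (n * 2 ^ (n ^ 2 / 2)) n n n n A ∧ IsNested n A

/-- `σ`: rotate a column vector downward by one step,
`(a_1,…,a_n) ↦ (a_n,a_1,…,a_{n-1})`. -/
def sigmaStep {n : ℕ} [NeZero n] (C : Fin n → ZMod 2) : Fin n → ZMod 2 :=
  fun i => C (i - 1)

instance instNeZeroTwoPow (d : ℕ) : NeZero (2 ^ d) := ⟨(Nat.two_pow_pos d).ne'⟩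

/-- Admissibility of a sequence of rotation amounts `m_0,…,m_{n-1}`:
`m_{n-1} = 0` and `m_{i+1} ≤ m_i ≤ m_{i+1} + 1`. -/
def Admissible {n : ℕ} (m : Fin n → ℕ) : Prop :=
  (∀ i : Fin n, (i : ℕ) = n - 1 → m i = 0) ∧
  ∀ i j : Fin n, (j : ℕ) = (i : ℕ) + 1 → m j ≤ m i ∧ m i ≤ m j + 1

/-- The Pascal-like matrix `M_d^{m_0,…,m_{n-1}}`: column `j` of `M_d`
rotated by `σ^{m_j}`. -/
def pascalLike (d : ℕ) (m : Fin (2 ^ d) → ℕ) :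
    Matrix (Fin (2 ^ d)) (Fin (2 ^ d)) (ZMod 2) :=
  Matrix.of fun i j => (sigmaStep^[m j] (fun r => Md d r j)) i

/-- `M_{i,j}` lies in the upper border of `M`: it is the topmost `1` of its column. -/
def UpperBorder {n : ℕ} (M : Matrix (Fin n) (Fin n) (ZMod 2)) (i j : Fin n) : Prop :=
  M i j = 1 ∧ ∀ r : Fin n, r < i → M r j = 0

/-- The enumeration `N_k` of all `n × n` matrices over `𝔽₂`:
entry `(i,j)` of `N_k` is the binary digit of `k` at position `n²−1−(i·n+j)`. -/
def Nmat (n k : ℕ) : Matrix (Fin n) (Fin n) (ZMod 2) :=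
  Matrix.of fun i j =>
    if Nat.testBit k (n ^ 2 - 1 - ((i : ℕ) * n + (j : ℕ))) then 1 else 0

/-- The integer whose binary digit at position `t` is the digit of `k` at position `2t`. -/
def evenPart (k : ℕ) : ℕ :=
  ∑ t ∈ Finset.range k, if Nat.testBit k (2 * t) then 2 ^ t else 0

/-- The integer whose binary digit at position `t` is the digit of `k` at position `2t+1`. -/
def oddPart (k : ℕ) : ℕ :=
  ∑ t ∈ Finset.range k, if Nat.testBit k (2 * t + 1) then 2 ^ t else 0

/-- The integer whose odd-position binary digits are those of `l` and whose
even-position binary digits are those of `m`; inverse of `k ↦ (oddPart k, evenPart k)`. -/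
def joinOE (l m : ℕ) : ℕ :=
  ∑ t ∈ Finset.range (l + m + 1),
    ((if Nat.testBit l t then 2 ^ (2 * t + 1) else 0) +
      (if Nat.testBit m t then 2 ^ (2 * t) else 0))

/-- The Pascal toroidal array `A_d` of size `n·2^{n²/2} × n·2^{n²/2}` (`n = 2^d`):
the matrix `M_d·N_k` is placed with upper left corner at `(odd(k)·n, even(k)·n)`. -/
def pascalArray (d : ℕ) :
    ZMod (2 ^ d * 2 ^ ((2 ^ d) ^ 2 / 2)) → ZMod (2 ^ d * 2 ^ ((2 ^ d) ^ 2 / 2)) → ZMod 2 :=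
  fun x y =>
    (Md d * Nmat (2 ^ d) (joinOE (x.val / 2 ^ d) (y.val / 2 ^ d)))
      ⟨x.val % 2 ^ d, Nat.mod_lt _ (Nat.two_pow_pos d)⟩
      ⟨y.val % 2 ^ d, Nat.mod_lt _ (Nat.two_pow_pos d)⟩

/-- The `(n,n,n,n)`-affine toroidal array determined by the Pascal-like matrix
given by rotations `m` and the matrix `Z`: the matrix `M·N_k ⊕ Z` is placed with
upper left corner at `(odd(k)·n, even(k)·n)`. -/
def affineArray (d : ℕ) (m : Fin (2 ^ d) → ℕ)
    (Z : Matrix (Fin (2 ^ d)) (Fin (2 ^ d)) (ZMod 2)) :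
    ZMod (2 ^ d * 2 ^ ((2 ^ d) ^ 2 / 2)) → ZMod (2 ^ d * 2 ^ ((2 ^ d) ^ 2 / 2)) → ZMod 2 :=
  fun x y =>
    (pascalLike d m * Nmat (2 ^ d) (joinOE (x.val / 2 ^ d) (y.val / 2 ^ d)) + Z)
      ⟨x.val % 2 ^ d, Nat.mod_lt _ (Nat.two_pow_pos d)⟩
      ⟨y.val % 2 ^ d, Nat.mod_lt _ (Nat.two_pow_pos d)⟩

theorem joinOE_zero_zero : joinOE 0 0 = 0 := by
  simp [joinOE]

theorem joinOE_zero_pow (t : ℕ) : joinOE 0 (2 ^ t) = 2 ^ (2 * t) := by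
  have ht : t < 2 ^ t := Nat.lt_two_pow_self
  unfold joinOE
  simp only [Nat.zero_testBit, Nat.testBit_two_pow]
  simp
  intro h
  omega

theorem joinOE_pow_zero (t : ℕ) : joinOE (2 ^ t) 0 = 2 ^ (2 * t + 1) := by
  have ht : t < 2 ^ t := Nat.lt_two_pow_self
  unfold joinOE
  simp only [Nat.zero_testBit, Nat.testBit_two_pow]
  simp
  intro h
  omega

theorem affineArray_block (d : ℕ) (m : Fin (2 ^ d) → ℕ)
    (Z : Matrix (Fin (2 ^ d)) (Fin (2 ^ d)) (ZMod 2)) (a b : ℕ)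
    (ha : a < 2 ^ ((2 ^ d) ^ 2 / 2)) (hb : b < 2 ^ ((2 ^ d) ^ 2 / 2)) (i j : Fin (2 ^ d)) :
    affineArray d m Z ((2 ^ d * a + (i : ℕ) : ℕ) : ZMod _) ((2 ^ d * b + (j : ℕ) : ℕ) : ZMod _)
      = (pascalLike d m * Nmat (2 ^ d) (joinOE a b) + Z) i j := by
  have key : ∀ (a : ℕ) (i : Fin (2 ^ d)), a < 2 ^ ((2 ^ d) ^ 2 / 2) →
      (((2 ^ d * a + (i : ℕ) : ℕ) : ZMod (2 ^ d * 2 ^ ((2 ^ d) ^ 2 / 2)))).val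
        = 2 ^ d * a + (i : ℕ) := by
    intro a i ha
    apply ZMod.val_natCast_of_lt
    have h1 : 2 ^ d * (a + 1) ≤ 2 ^ d * 2 ^ ((2 ^ d) ^ 2 / 2) := Nat.mul_le_mul_left _ ha
    have h2 := i.isLt
    rw [Nat.mul_add] at h1
    omega
  have hdiv : ∀ (a : ℕ) (i : Fin (2 ^ d)), (2 ^ d * a + (i : ℕ)) / 2 ^ d = a := by
    intro a i
    rw [Nat.mul_add_div (Nat.two_pow_pos d), Nat.div_eq_of_lt i.isLt, Nat.add_zero]
  have hmod : ∀ (a : ℕ) (i : Fin (2 ^ d)), (2 ^ d * a + (i : ℕ)) % 2 ^ d = i := by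
    intro a i
    rw [Nat.mul_add_mod, Nat.mod_eq_of_lt i.isLt]
  unfold affineArray
  simp only [key a i ha, key b j hb, hdiv, hmod]

theorem Nmat_zero (n : ℕ) : Nmat n 0 = 0 := by
  ext i j
  simp [Nmat]

theorem Nmat_pow (d : ℕ) (c r : Fin (2 ^ d)) :
    Nmat (2 ^ d) (2 ^ ((2 ^ d) ^ 2 - 1 - (c : ℕ) * 2 ^ d)) r 0 = if r = c then 1 else 0 := by
  have hlt : ∀ x : Fin (2 ^ d), (x : ℕ) * 2 ^ d + 2 ^ d ≤ (2 ^ d) ^ 2 := by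
    intro x
    have := Nat.mul_le_mul_right (2 ^ d) (Nat.succ_le_of_lt x.isLt)
    rw [Nat.succ_mul] at this
    rw [pow_two]
    exact this
  have hp := Nat.two_pow_pos d
  simp only [Nmat, Matrix.of_apply, Nat.testBit_two_pow, Fin.val_zero, Nat.add_zero]
  have : ((2 ^ d) ^ 2 - 1 - (c : ℕ) * 2 ^ d = (2 ^ d) ^ 2 - 1 - (r : ℕ) * 2 ^ d) ↔ r = c := by
    constructor
    · intro h
      have h1 := hlt c
      have h2 := hlt r
      have h3 : (r : ℕ) * 2 ^ d = (c : ℕ) * 2 ^ d := by omega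
      exact Fin.ext (Nat.eq_of_mul_eq_mul_right hp h3)
    · rintro rfl
      rfl
  simp [this]

/-- For `d ≥ 1` and `n = 2^d`, if the `(n,n,n,n)`-affine arrays of two
pairs `(M,Z)` and `(M′,Z′)` (a Pascal-like matrix and an `n × n` matrix over `𝔽₂`
each) are equal as functions, then `M = M′` and `Z = Z′`. -/
theorem affineArray_injective (d : ℕ) (hd : 1 ≤ d) (m m' : Fin (2 ^ d) → ℕ)
    (hm : Admissible m) (hm' : Admissible m')
    (Z Z' : Matrix (Fin (2 ^ d)) (Fin (2 ^ d)) (ZMod 2))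
    (h : affineArray d m Z = affineArray d m' Z') :
    pascalLike d m = pascalLike d m' ∧ Z = Z' := by
  have hblk : ∀ a b : ℕ, a < 2 ^ ((2 ^ d) ^ 2 / 2) → b < 2 ^ ((2 ^ d) ^ 2 / 2) →
      pascalLike d m * Nmat (2 ^ d) (joinOE a b) + Z
        = pascalLike d m' * Nmat (2 ^ d) (joinOE a b) + Z' := by
    intro a b ha hb
    ext i j
    rw [← affineArray_block d m Z a b ha hb, ← affineArray_block d m' Z' a b ha hb, h]
  have hZ : Z = Z' := by
    have h0 := hblk 0 0 (Nat.two_pow_pos _) (Nat.two_pow_pos _)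
    simpa [joinOE_zero_zero, Nmat_zero] using h0
  refine ⟨?_, hZ⟩
  subst hZ
  have heven : (2 ^ d) ^ 2 % 2 = 0 := by
    obtain ⟨e, rfl⟩ : ∃ e, d = e + 1 := ⟨d - 1, by omega⟩
    rw [pow_succ 2 e, mul_pow]
    omega
  have hpow : ∀ p, p < (2 ^ d) ^ 2 →
      pascalLike d m * Nmat (2 ^ d) (2 ^ p) = pascalLike d m' * Nmat (2 ^ d) (2 ^ p) := by
    intro p hp
    have ht : 2 ^ (p / 2) < 2 ^ ((2 ^ d) ^ 2 / 2) := by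
      apply Nat.pow_lt_pow_right (by norm_num)
      omega
    rcases Nat.mod_two_eq_zero_or_one p with h2 | h2
    · have := hblk 0 (2 ^ (p / 2)) (Nat.two_pow_pos _) ht
      rw [joinOE_zero_pow, show 2 * (p / 2) = p by omega] at this
      exact add_right_cancel this
    · have := hblk (2 ^ (p / 2)) 0 ht (Nat.two_pow_pos _)
      rw [joinOE_pow_zero, show 2 * (p / 2) + 1 = p by omega] at this
      exact add_right_cancel this
  ext i c
  have hc := hpow ((2 ^ d) ^ 2 - 1 - (c : ℕ) * 2 ^ d) (by
    have : 0 < (2 ^ d) ^ 2 := by positivity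
    omega)
  have hc' := congrFun (congrFun hc i) 0
  simpa only [Matrix.mul_apply, Nmat_pow, mul_ite, mul_one, mul_zero, Finset.sum_ite_eq',
    Finset.mem_univ, if_true] using hc'
end

section
/- Let d ≥ 0 and n = 2^d. The number of distinct Pascal-like matrices M_d^{m_0,…,m_{n−1}} (over all admissible sequences m_0,…,m_{n−1}) is exactly 2^{n−1}. -/
theorem MdEnt_zero_row (d : ℕ) : ∀ j, MdEnt d 0 j = 1 := by
  induction d with
  | zero => intro j; rfl
  | succ d ih =>
    intro j
    have h : 0 < 2 ^ d := Nat.two_pow_pos d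
    simp [MdEnt, ih]

theorem MdEnt_below (d : ℕ) : ∀ i j, j < i → i < 2 ^ d → MdEnt d i j = 0 := by
  induction d with
  | zero => intro i j h1 h2; simp at h2; omega
  | succ d ih =>
    intro i j h1 h2
    rw [pow_succ] at h2
    unfold MdEnt
    split_ifs with h3 h4 h5
    · exact ih _ _ h1 h3
    · omega
    · rfl
    · exact ih _ _ (by omega) (by omega)

open Fin.NatCast in
theorem sigmaStep_iter {n : ℕ} [NeZero n] (k : ℕ) (C : Fin n → ZMod 2) (i : Fin n) :
    (sigmaStep^[k] C) i = C (i - (k : Fin n)) := by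
  induction k generalizing i with
  | zero => simp
  | succ k ih =>
    rw [Function.iterate_succ_apply', sigmaStep, ih]
    congr 1
    push_cast
    abel

theorem Admissible.bound {n : ℕ} {m : Fin n → ℕ} (h : Admissible m) :
    ∀ k (i : Fin n), (i : ℕ) + k = n - 1 → m i ≤ k := by
  intro k
  induction k with
  | zero => intro i hi; rw [h.1 i (by omega)]
  | succ k ih =>
    intro i hi
    have h1 := ih ⟨i + 1, by omega⟩ (by simp; omega)
    have h2 := (h.2 i ⟨i + 1, by omega⟩ rfl).2
    omega

theorem pascalLike_top (d : ℕ) (m : Fin (2 ^ d) → ℕ) (j i : Fin (2 ^ d)) (hi : (i : ℕ) = m j) :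
    pascalLike d m i j = 1 := by
  simp only [pascalLike, Matrix.of_apply, sigmaStep_iter, Md, ← hi]
  simp [MdEnt_zero_row]

theorem pascalLike_above (d : ℕ) (m : Fin (2 ^ d) → ℕ) (hm : Admissible m)
    (j i : Fin (2 ^ d)) (hi : (i : ℕ) < m j) :
    pascalLike d m i j = 0 := by
  have hb := hm.bound (2 ^ d - 1 - j) j (by omega)
  simp only [pascalLike, Matrix.of_apply, sigmaStep_iter, Md]
  apply MdEnt_below _ _ _ _ (Fin.is_lt _)
  rw [Fin.sub_def]
  simp only [Fin.val_natCast]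
  rw [Nat.mod_eq_of_lt (a := m j) (by omega), Nat.mod_eq_of_lt (by omega)]
  omega

theorem pascalLike_inj (d : ℕ) (m m' : Fin (2 ^ d) → ℕ) (hm : Admissible m) (hm' : Admissible m')
    (h : pascalLike d m = pascalLike d m') : m = m' := by
  have key : ∀ m m' : Fin (2 ^ d) → ℕ, Admissible m → Admissible m' →
      pascalLike d m = pascalLike d m' → ∀ j, m' j ≤ m j := by
    intro m m' hm hm' h j
    by_contra hlt
    have hb := hm.bound (2 ^ d - 1 - j) j (by omega)
    have h1 := pascalLike_top d m j ⟨m j, by omega⟩ rfl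
    have h2 := pascalLike_above d m' hm' j ⟨m j, by omega⟩ (by simpa using hlt)
    rw [h, h2] at h1
    exact zero_ne_one h1
  funext j
  exact le_antisymm (key m' m hm' hm h.symm j) (key m m' hm hm' h j)

/-- Number of elements of `S` that are at least `i`. -/
def tailCount (S : Finset ℕ) (i : ℕ) : ℕ := (S.filter (fun x => i ≤ x)).card

theorem tailCount_step (S : Finset ℕ) (i : ℕ) :
    tailCount S i = tailCount S (i + 1) + if i ∈ S then 1 else 0 := by
  unfold tailCount
  split_ifs with h
  · have : S.filter (fun x => i ≤ x) = insert i (S.filter (fun x => i + 1 ≤ x)) := by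
      ext x
      simp only [Finset.mem_filter, Finset.mem_insert]
      constructor
      · rintro ⟨h1, h2⟩
        by_cases hx : x = i
        · exact Or.inl hx
        · exact Or.inr ⟨h1, by omega⟩
      · rintro (rfl | ⟨h1, h2⟩)
        · exact ⟨h, le_rfl⟩
        · exact ⟨h1, by omega⟩
    rw [this, Finset.card_insert_of_notMem (by simp)]
  · congr 1
    ext x
    simp only [Finset.mem_filter]
    constructor
    · rintro ⟨h1, h2⟩
      have : x ≠ i := fun e => h (e ▸ h1)
      exact ⟨h1, by omega⟩
    · rintro ⟨h1, h2⟩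
      exact ⟨h1, by omega⟩

theorem tailCount_top {n : ℕ} {S : Finset ℕ} (hS : S ⊆ Finset.range n) : tailCount S n = 0 := by
  unfold tailCount
  rw [Finset.card_eq_zero, Finset.filter_eq_empty_iff]
  intro x hx
  have := Finset.mem_range.1 (hS hx)
  omega

theorem tailCount_admissible {n : ℕ} {S : Finset ℕ} (hS : S ⊆ Finset.range (n - 1)) :
    Admissible (fun j : Fin n => tailCount S j) := by
  constructor
  · intro i hi
    simp only [hi]
    exact tailCount_top hS
  · intro i j hij
    simp only [hij]
    have := tailCount_step S i
    split_ifs at this <;> omega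

theorem admissible_eq_tailCount {n : ℕ} (m : Fin n → ℕ) (hm : Admissible m) :
    ∃ S ⊆ Finset.range (n - 1), m = fun j : Fin n => tailCount S j := by
  classical
  let S := (Finset.range (n - 1)).filter
    (fun i => ∃ (h1 : i < n) (h2 : i + 1 < n), m ⟨i, h1⟩ = m ⟨i + 1, h2⟩ + 1)
  have hS : S ⊆ Finset.range (n - 1) := Finset.filter_subset _ _
  refine ⟨S, hS, ?_⟩
  have key : ∀ k (i : Fin n), (i : ℕ) + k = n - 1 → m i = tailCount S i := by
    intro k
    induction k with
    | zero =>
      intro i hi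
      rw [hm.1 i (by omega), show (i : ℕ) = n - 1 by omega, tailCount_top hS]
    | succ k ih =>
      intro i hi
      have h1 := ih ⟨i + 1, by omega⟩ (by simp; omega)
      have h2 := hm.2 i ⟨i + 1, by omega⟩ rfl
      have h3 := tailCount_step S i
      have h4 : (i : ℕ) ∈ S ↔ m i = m ⟨i + 1, by omega⟩ + 1 := by
        simp only [S, Finset.mem_filter, Finset.mem_range]
        constructor
        · rintro ⟨_, _, _, h⟩
          exact h
        · intro h
          exact ⟨by omega, i.2, by omega, h⟩
      simp only at h1
      split_ifs at h3 with h5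
      · rw [h4] at h5; omega
      · rw [h4] at h5; omega
  funext j
  exact key (n - 1 - j) j (by omega)

theorem tailCount_inj {n : ℕ} {S T : Finset ℕ} (hS : S ⊆ Finset.range (n - 1))
    (hT : T ⊆ Finset.range (n - 1))
    (h : (fun j : Fin n => tailCount S j) = fun j : Fin n => tailCount T j) : S = T := by
  have h' : ∀ i, i < n → tailCount S i = tailCount T i := fun i hi => congrFun h ⟨i, hi⟩
  ext i
  by_cases hi : i < n - 1
  · have h1 := tailCount_step S i
    have h2 := tailCount_step T i
    rw [h' i (by omega), h' (i + 1) (by omega)] at h1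
    by_cases a : i ∈ S <;> by_cases b : i ∈ T <;> simp only [a, b, if_true, if_false] at h1 h2 ⊢ <;>
      omega
  · exact ⟨fun a => absurd (Finset.mem_range.1 (hS a)) hi,
      fun a => absurd (Finset.mem_range.1 (hT a)) hi⟩

/-- For `d ≥ 0` and `n = 2^d`, the number of distinct Pascal-like
matrices `M_d^{m_0,…,m_{n−1}}` over all admissible sequences is exactly `2^{n−1}`. -/
theorem card_pascalLike (d : ℕ) :
    {M : Matrix (Fin (2 ^ d)) (Fin (2 ^ d)) (ZMod 2) |
        ∃ m, Admissible m ∧ M = pascalLike d m}.ncard = 2 ^ (2 ^ d - 1) := by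
  have hset : {M : Matrix (Fin (2 ^ d)) (Fin (2 ^ d)) (ZMod 2) |
        ∃ m, Admissible m ∧ M = pascalLike d m} =
      Set.image (fun S : Finset ℕ => pascalLike d (fun j => tailCount S j))
        ((Finset.range (2 ^ d - 1)).powerset : Finset (Finset ℕ)) := by
    ext M
    simp only [Set.mem_setOf_eq, Set.mem_image, Finset.mem_coe, Finset.mem_powerset]
    constructor
    · rintro ⟨m, hm, rfl⟩
      obtain ⟨S, hS, rfl⟩ := admissible_eq_tailCount m hm
      exact ⟨S, hS, rfl⟩
    · rintro ⟨S, hS, rfl⟩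
      exact ⟨_, tailCount_admissible hS, rfl⟩
  rw [hset, Set.ncard_image_of_injOn, Set.ncard_coe_finset, Finset.card_powerset,
    Finset.card_range]
  intro S hS T hT h
  simp only [Finset.mem_coe, Finset.mem_powerset] at hS hT
  exact tailCount_inj hS hT
    (pascalLike_inj d _ _ (tailCount_admissible hS) (tailCount_admissible hT) h)
end
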